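/- Let G be a graph with an edge uv, and let G' be the graph obtained from G by replacing the edge uv with a path of length 5 (i.e., deleting uv and adding four new internal vertices w1,...,w4 forming a path u-w1-w2-w3-w4-v). Then the total domination number of G' equals the total domination number of G plus 2. -/

import Mathlib

open SimpleGraph

/-- `D` is a dominating set of `G`. -/
def IsDomSet {V : Type*} [DecidableEq V] (G : SimpleGraph V) (D : Finset V) : Prop :=
  ∀ v, v ∉ D → ∃ u ∈ D, G.Adj u v

/-- `D` is a total dominating set of `G`. -/
def IsTotDomSet {V : Type*} [DecidableEq V] (G : SimpleGraph V) (D : Finset V) : Prop :=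
  ∀ v : V, ∃ u ∈ D, G.Adj u v

/-- `u` and `v` are distinct and within distance at most 2 in `G`. -/
def WithinTwo {V : Type*} (G : SimpleGraph V) (u v : V) : Prop :=
  G.Adj u v ∨ ∃ w, G.Adj u w ∧ G.Adj w v

/-- `D` is a semitotal dominating set of `G`. -/
def IsSemiTDSet {V : Type*} [DecidableEq V] (G : SimpleGraph V) (D : Finset V) : Prop :=
  IsDomSet G D ∧ ∀ v ∈ D, ∃ u ∈ D, u ≠ v ∧ WithinTwo G u v

/-- The domination number of `G`. -/
noncomputable def gamma {V : Type*} [Fintype V] [DecidableEq V] (G : SimpleGraph V) : ℕ :=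
  sInf {n | ∃ D : Finset V, IsDomSet G D ∧ D.card = n}

/-- The total domination number of `G`. -/
noncomputable def gammaT {V : Type*} [Fintype V] [DecidableEq V] (G : SimpleGraph V) : ℕ :=
  sInf {n | ∃ D : Finset V, IsTotDomSet G D ∧ D.card = n}

/-- The semitotal domination number of `G`. -/
noncomputable def gammaT2 {V : Type*} [Fintype V] [DecidableEq V] (G : SimpleGraph V) : ℕ :=
  sInf {n | ∃ D : Finset V, IsSemiTDSet G D ∧ D.card = n}

/-- The graph obtained from `G` by replacing the edge `uv` with a path of length 5,
with four new internal vertices `w1, ..., w4` (indexed by `Fin 4`). -/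
def subdivide5 {V : Type*} (G : SimpleGraph V) (u v : V) : SimpleGraph (V ⊕ Fin 4) :=
  SimpleGraph.fromRel (fun a b =>
    match a, b with
    | Sum.inl a, Sum.inl b => G.Adj a b ∧ ¬(a = u ∧ b = v) ∧ ¬(a = v ∧ b = u)
    | Sum.inl a, Sum.inr i => (a = u ∧ i = 0) ∨ (a = v ∧ i = 3)
    | Sum.inr i, Sum.inr j => (j : ℕ) = (i : ℕ) + 1
    | Sum.inr _, Sum.inl _ => False)

theorem gammaT_le_card {V : Type*} [Fintype V] [DecidableEq V] {G : SimpleGraph V}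
    {D : Finset V} (hD : IsTotDomSet G D) : gammaT G ≤ D.card :=
  Nat.sInf_le ⟨D, hD, rfl⟩

theorem IsTotDomSet.exists_card_eq_gammaT {V : Type*} [Fintype V] [DecidableEq V]
    {G : SimpleGraph V} {D : Finset V} (hD : IsTotDomSet G D) :
    ∃ D₀ : Finset V, IsTotDomSet G D₀ ∧ D₀.card = gammaT G :=
  Nat.sInf_mem (s := {n | ∃ D : Finset V, IsTotDomSet G D ∧ D.card = n}) ⟨_, D, hD, rfl⟩

section Adjacency

variable {V : Type*} {G : SimpleGraph V} {u v : V}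

theorem subdivide5_adj_inl_inl {a b : V} :
    (subdivide5 G u v).Adj (Sum.inl a) (Sum.inl b) ↔
      G.Adj a b ∧ ¬(a = u ∧ b = v) ∧ ¬(a = v ∧ b = u) := by
  simp only [subdivide5, SimpleGraph.fromRel_adj, ne_eq, Sum.inl.injEq]
  have := G.adj_comm a b
  have : G.Adj a b → a ≠ b := fun h => h.ne
  tauto

theorem subdivide5_adj_inl_inr {a : V} {i : Fin 4} :
    (subdivide5 G u v).Adj (Sum.inl a) (Sum.inr i) ↔ (a = u ∧ i = 0) ∨ (a = v ∧ i = 3) := by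
  simp [subdivide5]

theorem subdivide5_adj_inr_inl {a : V} {i : Fin 4} :
    (subdivide5 G u v).Adj (Sum.inr i) (Sum.inl a) ↔ (a = u ∧ i = 0) ∨ (a = v ∧ i = 3) := by
  rw [SimpleGraph.adj_comm, subdivide5_adj_inl_inr]

theorem subdivide5_adj_inr_inr {i j : Fin 4} :
    (subdivide5 G u v).Adj (Sum.inr i) (Sum.inr j) ↔
      (j : ℕ) = (i : ℕ) + 1 ∨ (i : ℕ) = (j : ℕ) + 1 := by
  simp only [subdivide5, SimpleGraph.fromRel_adj, ne_eq, Sum.inr.injEq]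
  grind

end Adjacency

/-- Two of the new vertices extend a total dominating set of `G` to one of `subdivide5 G u v`. -/
theorem IsTotDomSet.exists_subdivide5 {V : Type*} [DecidableEq V] {G : SimpleGraph V}
    {u v : V} {D : Finset V} (hD : IsTotDomSet G D) :
    ∃ D' : Finset (V ⊕ Fin 4), IsTotDomSet (subdivide5 G u v) D' ∧ D'.card = D.card + 2 := by
  obtain ⟨i, j, hij, hu, hv, h⟩ : ∃ i j : Fin 4, i ≠ j ∧ (v ∈ D → i = 0 ∨ j = 0) ∧
      (u ∈ D → i = 3 ∨ j = 3) ∧ ∀ k : Fin 4, (k = 0 ∧ u ∈ D) ∨ (k = 3 ∧ v ∈ D) ∨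
        ((k : ℕ) = i + 1 ∨ (i : ℕ) = k + 1) ∨ ((k : ℕ) = j + 1 ∨ (j : ℕ) = k + 1) := by
    by_cases hu : u ∈ D <;> by_cases hv : v ∈ D
    · exact ⟨0, 3, by simp, by simp, by simp, by simp [hu, hv]; decide⟩
    · exact ⟨2, 3, by simp, by simp [hv], by simp, by simp [hu, hv]; decide⟩
    · exact ⟨0, 1, by simp, by simp, by simp [hu], by simp [hu, hv]; decide⟩
    · exact ⟨1, 2, by simp, by simp [hv], by simp [hu], by simp [hu, hv]; decide⟩
  refine ⟨D.disjSum {i, j}, ?_, by simp [Finset.card_pair hij]⟩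
  rintro (x | k)
  · obtain ⟨y, hy, hyx⟩ := hD x
    by_cases hvu : y = v ∧ x = u
    · obtain ⟨rfl, rfl⟩ := hvu
      exact ⟨Sum.inr 0, by simpa [eq_comm] using hu hy, by simp [subdivide5_adj_inr_inl]⟩
    by_cases huv : y = u ∧ x = v
    · obtain ⟨rfl, rfl⟩ := huv
      exact ⟨Sum.inr 3, by simpa [eq_comm] using hv hy, by simp [subdivide5_adj_inr_inl]⟩
    exact ⟨Sum.inl y, by simpa using hy, subdivide5_adj_inl_inl.2 ⟨hyx, huv, hvu⟩⟩
  · rcases h k with ⟨hk, hu⟩ | ⟨hk, hv⟩ | hk | hk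
    · exact ⟨Sum.inl u, by simpa using hu, by simp [subdivide5_adj_inl_inr, hk]⟩
    · exact ⟨Sum.inl v, by simpa using hv, by simp [subdivide5_adj_inl_inr, hk]⟩
    · exact ⟨Sum.inr i, by simp, subdivide5_adj_inr_inr.2 hk⟩
    · exact ⟨Sum.inr j, by simp, subdivide5_adj_inr_inr.2 hk⟩

/-- A total dominating set of `subdivide5 G u v` yields one of `G` with two fewer vertices. -/
theorem IsTotDomSet.exists_of_subdivide5 {V : Type*} [DecidableEq V] {G : SimpleGraph V}
    {u v : V} (huv : G.Adj u v) {D : Finset (V ⊕ Fin 4)}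
    (hD : IsTotDomSet (subdivide5 G u v) D) :
    ∃ D₀ : Finset V, IsTotDomSet G D₀ ∧ D₀.card + 2 ≤ D.card := by
  have h0 : Sum.inl u ∈ D ∨ Sum.inr 1 ∈ D := by
    obtain ⟨a | i, ha, h⟩ := hD (Sum.inr 0)
    · have := subdivide5_adj_inl_inr.1 h
      grind
    · have := subdivide5_adj_inr_inr.1 h
      fin_cases i <;> simp_all
  have h1 : Sum.inr 0 ∈ D ∨ Sum.inr 2 ∈ D := by
    obtain ⟨a | i, ha, h⟩ := hD (Sum.inr 1)
    · have := subdivide5_adj_inl_inr.1 h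
      grind
    · have := subdivide5_adj_inr_inr.1 h
      fin_cases i <;> simp_all
  have h2 : Sum.inr 1 ∈ D ∨ Sum.inr 3 ∈ D := by
    obtain ⟨a | i, ha, h⟩ := hD (Sum.inr 2)
    · have := subdivide5_adj_inl_inr.1 h
      grind
    · have := subdivide5_adj_inr_inr.1 h
      fin_cases i <;> simp_all
  have h3 : Sum.inl v ∈ D ∨ Sum.inr 2 ∈ D := by
    obtain ⟨a | i, ha, h⟩ := hD (Sum.inr 3)
    · have := subdivide5_adj_inl_inr.1 h
      grind
    · have := subdivide5_adj_inr_inr.1 h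
      fin_cases i <;> simp_all
  let U : Finset V := if Sum.inr 1 ∈ D ∧ Sum.inr 3 ∈ D then {u} else ∅
  let W : Finset V := if Sum.inr 0 ∈ D ∧ Sum.inr 2 ∈ D then {v} else ∅
  refine ⟨D.toLeft ∪ (U ∪ W), ?_, ?_⟩
  · intro x
    obtain ⟨a | i, ha, h⟩ := hD (Sum.inl x)
    · exact ⟨a, by simp [ha], (subdivide5_adj_inl_inl.1 h).1⟩
    · rcases subdivide5_adj_inr_inl.1 h with ⟨rfl, rfl⟩ | ⟨rfl, rfl⟩
      · exact ⟨v, by simp only [Finset.mem_union, Finset.mem_toLeft, W]; grind, huv.symm⟩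
      · exact ⟨u, by simp only [Finset.mem_union, Finset.mem_toLeft, U]; grind, huv⟩
  · have hR : U.card + W.card + 2 ≤ D.toRight.card := by
      have hcard : D.toRight.card = ∑ i : Fin 4, if Sum.inr i ∈ D then 1 else 0 := by
        rw [← Finset.card_filter]
        congr 1
        ext i
        simp
      rw [hcard, Fin.sum_univ_four]
      simp only [U, W]
      split_ifs <;> simp_all
    have := D.card_toLeft_add_card_toRight
    have := Finset.card_union_le D.toLeft (U ∪ W)
    have := Finset.card_union_le U W
    omega

theorem total_subdivide5 {V : Type*} [Fintype V] [DecidableEq V] (G : SimpleGraph V)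
    (hiso : ∀ w : V, ∃ x, G.Adj w x) (u v : V) (huv : G.Adj u v) :
    gammaT (subdivide5 G u v) = gammaT G + 2 := by
  have huniv : IsTotDomSet G Finset.univ := fun w =>
    (hiso w).imp fun x hx => ⟨Finset.mem_univ x, hx.symm⟩
  obtain ⟨D, hD, hDcard⟩ := huniv.exists_card_eq_gammaT
  obtain ⟨D', hD', hD'card⟩ := hD.exists_subdivide5 (u := u) (v := v)
  obtain ⟨E', hE', hE'card⟩ := hD'.exists_card_eq_gammaT
  obtain ⟨E, hE, hEcard⟩ := hE'.exists_of_subdivide5 huv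
  have := gammaT_le_card hD'
  have := gammaT_le_card hE
  omega
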